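/- Let (A_n)_{n≥1} and B be real random variables such that for each n, A_n is independent of B, the characteristic function of B vanishes nowhere on ℝ, and A_n + B converges in distribution to some random variable C as n → ∞. Then (A_n)_{n≥1} converges in distribution; more precisely, there exists a probability distribution ν on ℝ whose characteristic function equals t ↦ φ_C(t)/φ_B(t) such that the laws of A_n converge weakly to ν. -/

import Mathlib

open MeasureTheory ProbabilityTheory Filter BoundedContinuousFunction

/-- The characteristic function of a probability distribution `ν` on `ℝ`:
`φ_ν(t) = ∫ e^{itx} dν(x)`. -/
noncomputable def charFunOf (ν : MeasureTheory.Measure ℝ) (t : ℝ) : ℂ :=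
  ∫ x, Complex.exp (Complex.I * t * x) ∂ν

lemma charFunOf_eq_charFun (ν : MeasureTheory.Measure ℝ) (t : ℝ) :
    charFunOf ν t = charFun ν t := by
  rw [charFunOf, charFun_apply_real]
  congr 1
  ext x
  ring_nf

/-- **Convergence of one summand given convergence of independent sums.**
If `A_n` is independent of `B` for each `n`, the characteristic function of `B` never
vanishes, and `A_n + B → C` in distribution, then the laws of `A_n` converge weakly to a
probability distribution `ν` whose characteristic function is `φ_C / φ_B`. -/
theorem tendsto_in_distribution_of_add_indep
    {Ω : Type*} [MeasureSpace Ω] [IsProbabilityMeasure (ℙ : Measure Ω)]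
    (A : ℕ → Ω → ℝ) (B C : Ω → ℝ)
    (hAmeas : ∀ n, Measurable (A n)) (hBmeas : Measurable B) (hCmeas : Measurable C)
    (hindep : ∀ n, IndepFun (A n) B ℙ)
    (hB_ne : ∀ t : ℝ, charFunOf (Measure.map B ℙ) t ≠ 0)
    (hconv : ∀ f : ℝ →ᵇ ℝ,
      Tendsto (fun n => ∫ ω, f (A n ω + B ω) ∂ℙ) atTop (nhds (∫ ω, f (C ω) ∂ℙ))) :
    ∃ ν : MeasureTheory.Measure ℝ, IsProbabilityMeasure ν ∧
      (∀ t : ℝ, charFunOf ν t =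
        charFunOf (Measure.map C ℙ) t / charFunOf (Measure.map B ℙ) t) ∧
      ∀ f : ℝ →ᵇ ℝ,
        Tendsto (fun n => ∫ ω, f (A n ω) ∂ℙ) atTop (nhds (∫ x, f x ∂ν)) := by
  simp only [charFunOf_eq_charFun] at *
  have pA : ∀ n, IsProbabilityMeasure (Measure.map (A n) ℙ) := fun n =>
    Measure.isProbabilityMeasure_map (hAmeas n).aemeasurable
  have pB : IsProbabilityMeasure (Measure.map B ℙ) :=
    Measure.isProbabilityMeasure_map hBmeas.aemeasurable
  have pC : IsProbabilityMeasure (Measure.map C ℙ) :=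
    Measure.isProbabilityMeasure_map hCmeas.aemeasurable
  have mAB : ∀ n, Measurable (fun ω => A n ω + B ω) := fun n => (hAmeas n).add hBmeas
  have pAB : ∀ n, IsProbabilityMeasure (Measure.map (fun ω => A n ω + B ω) ℙ) := fun n =>
    Measure.isProbabilityMeasure_map (mAB n).aemeasurable
  let μ : ℕ → ProbabilityMeasure ℝ := fun n => ⟨Measure.map (A n) ℙ, pA n⟩
  let σ : ℕ → ProbabilityMeasure ℝ := fun n => ⟨Measure.map (fun ω => A n ω + B ω) ℙ, pAB n⟩
  let γ : ProbabilityMeasure ℝ := ⟨Measure.map C ℙ, pC⟩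
  -- the sums converge weakly, hence so do their characteristic functions
  have hσ : Tendsto σ atTop (nhds γ) := by
    rw [ProbabilityMeasure.tendsto_iff_forall_integral_tendsto]
    intro f
    have h1 : ∀ n, ∫ x, f x ∂(σ n : Measure ℝ) = ∫ ω, f (A n ω + B ω) ∂ℙ := fun n =>
      integral_map (mAB n).aemeasurable f.continuous.aestronglyMeasurable
    have h2 : ∫ x, f x ∂(γ : Measure ℝ) = ∫ ω, f (C ω) ∂ℙ :=
      integral_map hCmeas.aemeasurable f.continuous.aestronglyMeasurable
    simp only [h1, h2]
    exact hconv f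
  rw [ProbabilityMeasure.tendsto_iff_tendsto_charFun] at hσ
  have hprod : ∀ n t, charFun (σ n : Measure ℝ) t
      = charFun (μ n : Measure ℝ) t * charFun (Measure.map B ℙ) t := fun n t =>
    congrFun ((hindep n).charFun_map_fun_add_eq_mul (hAmeas n).aemeasurable
      hBmeas.aemeasurable) t
  -- characteristic functions of `A n` converge to the quotient
  have hμ : ∀ t, Tendsto (fun n => charFun (μ n : Measure ℝ) t) atTop
      (nhds (charFun (Measure.map C ℙ) t / charFun (Measure.map B ℙ) t)) := by
    intro t
    refine ((hσ t).div_const (charFun (Measure.map B ℙ) t)).congr fun n => ?_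
    rw [hprod, mul_div_cancel_right₀ _ (hB_ne t)]
  have hcont : Continuous (fun t => charFun (Measure.map C ℙ) t / charFun (Measure.map B ℙ) t) :=
    Continuous.div (by fun_prop) (by fun_prop) hB_ne
  have htight : IsTightMeasureSet (Set.range fun n => (μ n : Measure ℝ)) :=
    isTightMeasureSet_of_tendsto_charFun hcont.continuousAt hμ
  have hcompact : IsCompact (closure (Set.range μ)) :=
    isCompact_closure_of_isTightMeasureSet (by
      convert! htight using 1
      ext; simp)
  -- a cluster point of the laws of `A n`
  obtain ⟨ν, -, hν⟩ := hcompact.ultrafilter_le_nhds ((hyperfilter ℕ).map μ)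
    (.trans (by simp) (monotone_principal subset_closure))
  have hν' : Tendsto μ (hyperfilter ℕ : Filter ℕ) (nhds ν) := hν
  have hνchar : ∀ t, charFun (ν : Measure ℝ) t
      = charFun (Measure.map C ℙ) t / charFun (Measure.map B ℙ) t := by
    intro t
    rw [ProbabilityMeasure.tendsto_iff_forall_integral_rclike_tendsto ℂ] at hν'
    have h1 := hν' (innerProbChar t)
    simp only [← charFun_eq_integral_innerProbChar] at h1
    exact tendsto_nhds_unique h1 ((hμ t).mono_left Nat.hyperfilter_le_atTop)
  refine ⟨ν, inferInstance, hνchar, fun f => ?_⟩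
  have hlim : Tendsto μ atTop (nhds ν) := by
    rw [ProbabilityMeasure.tendsto_iff_tendsto_charFun]
    intro t
    rw [hνchar]
    exact hμ t
  rw [ProbabilityMeasure.tendsto_iff_forall_integral_tendsto] at hlim
  refine (hlim f).congr fun n => ?_
  exact integral_map (hAmeas n).aemeasurable f.continuous.aestronglyMeasurable
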